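/- arXiv:1805.06929 — 2 statements merged into one kernel-verified Lean document; each statement's English description precedes it below -/
import Mathlib

section
/- Let α, ν, β > 0, κ ∈ (0,1) with κ(α/ν − 1) < 1, and let f be the κGG density. Set p = 1/(2κ) − (α−ν)/(2ν) and q = α/ν (both positive). Then for every x > 0, the cumulative distribution function satisfies ∫₀^x f(t) dt = 1 − I_X(p, q), where X = (exp_κ(−(x/β)^ν))^{2κ} and I_z(p,q) = (∫₀^z t^{p−1}(1−t)^{q−1} dt) / (∫₀^1 t^{p−1}(1−t)^{q−1} dt) is the regularized incomplete beta function. -/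
open Real MeasureTheory Filter Set

/-- The κ-deformed exponential of Kaniadakis. -/
noncomputable def kexp (κ x : ℝ) : ℝ := (Real.sqrt (1 + κ^2 * x^2) + κ * x) ^ (1/κ)

/-- The κ-deformed logarithm of Kaniadakis. -/
noncomputable def klog (κ x : ℝ) : ℝ := (x ^ κ - x ^ (-κ)) / (2*κ)

/-- The κ-deformed Gamma function (closed form in terms of the Euler Gamma function). -/
noncomputable def kGamma (κ z : ℝ) : ℝ :=
  ((1 - κ*(z-1)) / (2*κ) ^ (z-1)) *
    (Real.Gamma (1/(2*κ) - (z-1)/2) / Real.Gamma (1/(2*κ) + (z-1)/2)) * Real.Gamma z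

/-- The κ-Generalized Gamma (κGG) density. -/
noncomputable def kGG (α ν β κ x : ℝ) : ℝ :=
  (1 - κ^2*(α/ν - 1)^2) * (ν/β) * (kGamma κ (α/ν))⁻¹ * (x/β) ^ (α-1) *
    kexp κ (-((x/β) ^ ν)) / Real.sqrt (1 + κ^2 * (x/β) ^ (2*ν))

/-- The regularized incomplete beta function. -/
noncomputable def regIncBeta (z p q : ℝ) : ℝ :=
  (∫ t in (0:ℝ)..z, t ^ (p-1) * (1-t) ^ (q-1)) /
    (∫ t in (0:ℝ)..(1:ℝ), t ^ (p-1) * (1-t) ^ (q-1))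

/-- The real Beta integrand is integrable on `[0, 1]`. -/
lemma intervalIntegrable_rpow_mul_one_sub_rpow {p q : ℝ} (hp : 0 < p) (hq : 0 < q) :
    IntervalIntegrable (fun t : ℝ => t ^ (p - 1) * (1 - t) ^ (q - 1)) volume 0 1 := by
  have hc := Complex.betaIntegral_convergent (u := p) (v := q) (by simpa) (by simpa)
  rw [intervalIntegrable_iff_integrableOn_Ioc_of_le zero_le_one] at hc ⊢
  refine IntegrableOn.congr_fun hc.re (fun t ht => ?_) measurableSet_Ioc
  have h1 : (0 : ℝ) ≤ 1 - t := sub_nonneg.2 ht.2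
  have h2 : ((t : ℂ) ^ ((p : ℂ) - 1) * (1 - (t : ℂ)) ^ ((q : ℂ) - 1)) =
      ((t ^ (p - 1) * (1 - t) ^ (q - 1) : ℝ) : ℂ) := by
    push_cast [Complex.ofReal_cpow ht.1.le, Complex.ofReal_cpow h1]
    rfl
  simp only [h2]
  exact Complex.ofReal_re _

/-- The real Beta integral is the Beta function. -/
lemma integral_rpow_mul_one_sub_rpow {p q : ℝ} (hp : 0 < p) (hq : 0 < q) :
    ∫ t in (0 : ℝ)..1, t ^ (p - 1) * (1 - t) ^ (q - 1) = ProbabilityTheory.beta p q := by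
  have h0 : Complex.betaIntegral p q =
      ((∫ t in (0 : ℝ)..1, t ^ (p - 1) * (1 - t) ^ (q - 1) : ℝ) : ℂ) := by
    rw [Complex.betaIntegral, ← intervalIntegral.integral_ofReal]
    refine intervalIntegral.integral_congr fun t ht => ?_
    rw [uIcc_of_le zero_le_one] at ht
    have h1 : (0 : ℝ) ≤ 1 - t := sub_nonneg.2 ht.2
    push_cast [Complex.ofReal_cpow ht.1, Complex.ofReal_cpow h1]
    rfl
  rw [ProbabilityTheory.beta_eq_betaIntegralReal p q hp hq, h0, Complex.ofReal_re]

lemma sqrt_one_add_sq_sub_pos (y : ℝ) : 0 < √(1 + y ^ 2) - y :=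
  sub_pos.2 (Real.lt_sqrt_of_sq_lt (by linarith))

lemma kexp_neg (κ w : ℝ) : kexp κ (-w) = (√(1 + (κ * w) ^ 2) - κ * w) ^ (1 / κ) := by
  rw [kexp]
  congr 1
  ring_nf

lemma kexp_neg_rpow_two_mul {κ : ℝ} (hκ : 0 < κ) (w : ℝ) :
    kexp κ (-w) ^ (2 * κ) = (√(1 + (κ * w) ^ 2) - κ * w) ^ 2 := by
  rw [kexp_neg, ← Real.rpow_mul (sqrt_one_add_sq_sub_pos _).le,
    show 1 / κ * (2 * κ) = 2 by field_simp, Real.rpow_two]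

lemma one_sub_sq_sqrt_one_add_sq_sub (y : ℝ) :
    1 - (√(1 + y ^ 2) - y) ^ 2 = 2 * y * (√(1 + y ^ 2) - y) := by
  have := Real.sq_sqrt (show 0 ≤ 1 + y ^ 2 by positivity)
  linear_combination -this

lemma hasDerivAt_sq_sqrt_one_add_sq_sub (y : ℝ) :
    HasDerivAt (fun y : ℝ => (√(1 + y ^ 2) - y) ^ 2)
      (-2 * (√(1 + y ^ 2) - y) ^ 2 / √(1 + y ^ 2)) y := by
  have hpos : 0 < 1 + y ^ 2 := by positivity
  have hS := Real.sqrt_pos.2 hpos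
  have h1 : HasDerivAt (fun y : ℝ => 1 + y ^ 2) (2 * y) y := by
    simpa using (hasDerivAt_pow 2 y).const_add 1
  have h2 := ((h1.sqrt hpos.ne').sub (hasDerivAt_id y)).pow 2
  convert! h2 using 1
  simp only [Pi.sub_apply, id]
  field_simp
  push_cast
  ring

/-- The normalizing constant of the κGG density in terms of the Beta function. -/
lemma kGamma_normalization {κ q : ℝ} (hκ : κ ∈ Set.Ioo (0 : ℝ) 1) (hq : 0 < q)
    (h : κ * (q - 1) < 1) :
    (1 - κ ^ 2 * (q - 1) ^ 2) * (kGamma κ q)⁻¹ =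
      2 * κ * (2 * κ) ^ (q - 1) / ProbabilityTheory.beta (1 / (2 * κ) - (q - 1) / 2) q := by
  obtain ⟨hκ0, hκ1⟩ := hκ
  have hA : 0 < 1 + κ * (q - 1) := by nlinarith [mul_pos hκ0 hq]
  have hA' : 0 < 1 / (2 * κ) + (q - 1) / 2 := by
    rw [show 1 / (2 * κ) + (q - 1) / 2 = (1 + κ * (q - 1)) / (2 * κ) by field_simp]
    positivity
  have hB : 0 < 1 - κ * (q - 1) := by linarith
  have hp : 0 < 1 / (2 * κ) - (q - 1) / 2 := by
    rw [show 1 / (2 * κ) - (q - 1) / 2 = (1 - κ * (q - 1)) / (2 * κ) by field_simp]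
    positivity
  rw [kGamma, ProbabilityTheory.beta,
    show 1 / (2 * κ) - (q - 1) / 2 + q = 1 / (2 * κ) + (q - 1) / 2 + 1 by ring,
    Real.Gamma_add_one hA'.ne']
  have g1 := Real.Gamma_pos_of_pos hA'
  have g2 := Real.Gamma_pos_of_pos hp
  have g3 := Real.Gamma_pos_of_pos hq
  have g4 : 0 < (2 * κ) ^ (q - 1) := by positivity
  rw [show 1 / (2 * κ) + (q - 1) / 2 = (1 + κ * (q - 1)) / (2 * κ) by field_simp] at g1 ⊢
  generalize Real.Gamma ((1 + κ * (q - 1)) / (2 * κ)) = G1 at *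
  generalize Real.Gamma (1 / (2 * κ) - (q - 1) / 2) = G2 at *
  generalize Real.Gamma q = G3 at *
  generalize (2 * κ) ^ (q - 1) = G4 at *
  rw [show 1 - κ ^ 2 * (q - 1) ^ 2 = (1 - κ * (q - 1)) * (1 + κ * (q - 1)) by ring]
  generalize 1 - κ * (q - 1) = b at *
  generalize 1 + κ * (q - 1) = a at *
  field_simp

/-- The Beta integrand pulled back along `y ↦ (√(1 + y²) - y)²`. -/
lemma beta_integrand_sq_sqrt_one_add_sq_sub {y : ℝ} (hy : 0 < y) (p q : ℝ) :
    (√(1 + y ^ 2) - y) ^ 2 * (((√(1 + y ^ 2) - y) ^ 2) ^ (p - 1) *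
      (1 - (√(1 + y ^ 2) - y) ^ 2) ^ (q - 1)) =
    (2 * y) ^ (q - 1) * (√(1 + y ^ 2) - y) ^ (2 * p + (q - 1)) := by
  rw [one_sub_sq_sqrt_one_add_sq_sub]
  have hs := sqrt_one_add_sq_sub_pos y
  generalize √(1 + y ^ 2) - y = s at *
  rw [Real.mul_rpow (by positivity) hs.le, Real.rpow_add hs,
    show s ^ (2 * p) = s ^ 2 * (s ^ 2) ^ (p - 1) by
      rw [Real.rpow_mul hs.le, Real.rpow_two, Real.rpow_sub_one (by positivity)]
      field_simp]
  ring

lemma hasDerivAt_mul_div_rpow (κ ν : ℝ) {β t : ℝ} (hβ : 0 < β) (ht : 0 < t) :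
    HasDerivAt (fun t : ℝ => κ * (t / β) ^ ν) (κ * (ν / β * (t / β) ^ (ν - 1))) t := by
  have h := (((hasDerivAt_id t).div_const β).rpow_const (p := ν)
    (Or.inl (div_pos ht hβ).ne')).const_mul κ
  convert! h using 1
  simp only [id]
  ring

/-- The κGG density is the pullback of the Beta density along a decreasing substitution. -/
lemma kGG_eq_beta_pullback {α ν β κ t : ℝ} (hα : 0 < α) (hν : 0 < ν) (hβ : 0 < β)
    (hκ : κ ∈ Set.Ioo (0 : ℝ) 1) (h : κ * (α / ν - 1) < 1) (ht : 0 < t) :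
    kGG α ν β κ t = -(ProbabilityTheory.beta (1 / (2 * κ) - (α / ν - 1) / 2) (α / ν))⁻¹ *
      (-2 * (√(1 + (κ * (t / β) ^ ν) ^ 2) - κ * (t / β) ^ ν) ^ 2 /
          √(1 + (κ * (t / β) ^ ν) ^ 2) * (κ * (ν / β * (t / β) ^ (ν - 1))) *
        (((√(1 + (κ * (t / β) ^ ν) ^ 2) - κ * (t / β) ^ ν) ^ 2) ^
            (1 / (2 * κ) - (α / ν - 1) / 2 - 1) *
          (1 - (√(1 + (κ * (t / β) ^ ν) ^ 2) - κ * (t / β) ^ ν) ^ 2) ^ (α / ν - 1))) := by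
  have hκ0 := hκ.1
  have hr : 0 < t / β := div_pos ht hβ
  have hN := kGamma_normalization hκ (div_pos hα hν) h
  have hI := beta_integrand_sq_sqrt_one_add_sq_sub (y := κ * (t / β) ^ ν) (by positivity)
    (1 / (2 * κ) - (α / ν - 1) / 2) (α / ν)
  rw [show 2 * (1 / (2 * κ) - (α / ν - 1) / 2) + (α / ν - 1) = 1 / κ by field_simp; ring,
    ← kexp_neg, ← mul_assoc 2 κ, Real.mul_rpow (by positivity) (by positivity),
    ← Real.rpow_mul hr.le, show ν * (α / ν - 1) = α - ν by field_simp] at hI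
  have hw : (t / β) ^ (α - 1) = (t / β) ^ (α - ν) * (t / β) ^ (ν - 1) := by
    rw [← Real.rpow_add hr]
    ring_nf
  have hS : κ ^ 2 * (t / β) ^ (2 * ν) = (κ * (t / β) ^ ν) ^ 2 := by
    rw [mul_pow, mul_comm 2 ν, Real.rpow_mul hr.le, Real.rpow_two]
  rw [kGG, hS, hw]
  linear_combination (ν / β * ((t / β) ^ (α - ν) * (t / β) ^ (ν - 1)) *
      kexp κ (-(t / β) ^ ν) / √(1 + (κ * (t / β) ^ ν) ^ 2)) * hN -
    (2 * κ * (ProbabilityTheory.beta (1 / (2 * κ) - (α / ν - 1) / 2) (α / ν))⁻¹ *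
      (ν / β * (t / β) ^ (ν - 1)) / √(1 + (κ * (t / β) ^ ν) ^ 2)) * hI

/-- Cumulative distribution function of the κGG density. -/
theorem kGG_cdf (α ν β κ : ℝ) (hα : 0 < α) (hν : 0 < ν) (hβ : 0 < β)
    (hκ : κ ∈ Set.Ioo (0:ℝ) 1) (h : κ * (α/ν - 1) < 1) (x : ℝ) (hx : 0 < x) :
    ∫ t in Set.Ioc (0:ℝ) x, kGG α ν β κ t =
      1 - regIncBeta ((kexp κ (-((x/β) ^ ν))) ^ (2*κ))
            (1/(2*κ) - (α-ν)/(2*ν)) (α/ν) := by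
  have hκ0 := hκ.1
  have hq : 0 < α / ν := div_pos hα hν
  rw [show 1 / (2 * κ) - (α - ν) / (2 * ν) = 1 / (2 * κ) - (α / ν - 1) / 2 by field_simp]
  have hp : 0 < 1 / (2 * κ) - (α / ν - 1) / 2 := by
    rw [show 1 / (2 * κ) - (α / ν - 1) / 2 = (1 - κ * (α / ν - 1)) / (2 * κ) by field_simp]
    exact div_pos (by linarith) (by positivity)
  have hpull := fun t ht => kGG_eq_beta_pullback (t := t) hα hν hβ hκ h ht
  rw [kexp_neg_rpow_two_mul hκ0, regIncBeta, integral_rpow_mul_one_sub_rpow hp hq]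
  have hBpos := ProbabilityTheory.beta_pos hp hq
  have hint := intervalIntegrable_rpow_mul_one_sub_rpow hp hq
  have htot := integral_rpow_mul_one_sub_rpow hp hq
  generalize 1 / (2 * κ) - (α / ν - 1) / 2 = p at *
  set Y : ℝ → ℝ := fun t => (√(1 + (κ * (t / β) ^ ν) ^ 2) - κ * (t / β) ^ ν) ^ 2 with hY
  have hY0 : Y 0 = 1 := by simp [hY, Real.zero_rpow hν.ne']
  have hYx0 : 0 ≤ Y x := sq_nonneg _
  have hYx1 : Y x ≤ 1 := by
    have hy : 0 < κ * (x / β) ^ ν := by positivity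
    have := mul_pos hy (sqrt_one_add_sq_sub_pos (κ * (x / β) ^ ν))
    linarith [one_sub_sq_sqrt_one_add_sq_sub (κ * (x / β) ^ ν)]
  have hYcont : Continuous Y := by
    have : Continuous fun t : ℝ => (t / β) ^ ν :=
      (continuous_id.div_const β).rpow_const fun _ => Or.inr hν.le
    fun_prop
  have hsub := integral_Icc_deriv_smul_of_deriv_nonpos (a := 0) (b := x) (f := Y)
    (g := fun y => y ^ (p - 1) * (1 - y) ^ (α / ν - 1)) hYcont.continuousOn
    (fun t ht => (hasDerivAt_sq_sqrt_one_add_sq_sub _).comp t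
      (hasDerivAt_mul_div_rpow κ ν hβ ht.1))
    (fun t ht => by
      have hr : 0 < t / β := div_pos ht.1 hβ
      refine mul_nonpos_of_nonpos_of_nonneg ?_ (by positivity)
      exact div_nonpos_of_nonpos_of_nonneg
        (mul_nonpos_of_nonpos_of_nonneg (by norm_num) (sq_nonneg _)) (Real.sqrt_nonneg _))
    hx.le
  rw [setIntegral_congr_fun measurableSet_Ioc fun t ht => hpull t ht.1, integral_const_mul,
    ← integral_Icc_eq_integral_Ioc]
  simp only [smul_eq_mul] at hsub
  rw [hsub, hY0, integral_Icc_eq_integral_Ioc, ← intervalIntegral.integral_of_le hYx1]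
  have hmem : Y x ∈ uIcc (0 : ℝ) 1 := by
    rw [uIcc_of_le zero_le_one]
    exact ⟨hYx0, hYx1⟩
  have hadd := intervalIntegral.integral_add_adjacent_intervals
    (hint.mono_set (uIcc_subset_uIcc_left hmem)) (hint.mono_set (uIcc_subset_uIcc_right hmem))
  rw [htot] at hadd
  rw [← sub_eq_of_eq_add' hadd.symm]
  rw [neg_mul_neg, inv_mul_eq_div, sub_div, div_self hBpos.ne']
end

section
/- Let α, ν, β > 0, κ ∈ (0,1) with κ(α/ν − 1) < 1 and ν/κ + (ν − α) > 2, and let f be the κGG density with mean m = ∫₀^∞ x f(x) dx. Then the variance σ² = ∫₀^∞ x² f(x) dx − m² equals β² · [1 + κ(α/ν − 1)] / ((2κ)^{2/ν} Γ(α/ν)) · Γ(1/(2κ) + (α−ν)/(2ν))/Γ(1/(2κ) − (α−ν)/(2ν)) · { Γ((α+2)/ν)/(1 + κ((α+2)/ν − 1)) · Γ(1/(2κ) − (α−ν+2)/(2ν))/Γ(1/(2κ) + (α−ν+2)/(2ν)) − [1 + κ(α/ν − 1)]/Γ(α/ν) · Γ(1/(2κ) + (α−ν)/(2ν))/Γ(1/(2κ)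 − (α−ν)/(2ν)) · [ Γ((α+1)/ν)/(1 + κ((α+1)/ν − 1)) · Γ(1/(2κ) − (α−ν+1)/(2ν))/Γ(1/(2κ) + (α−ν+1)/(2ν)) ]² }. -/
open Real MeasureTheory Filter Set

/-- The substitution `x = sinh (-(log t) / 2) / κ`, mapping `(0, 1)` onto `(0, ∞)`, in algebraic
form. It rationalizes `√(1 + κ² x²)` up to the factor `√t`. -/
noncomputable def kSubst (κ t : ℝ) : ℝ := (1 - t) / (2 * κ * √t)

lemma sqrt_one_add_sq_kSubst {κ t : ℝ} (hκ : 0 < κ) (ht : 0 < t) :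
    √(1 + κ ^ 2 * kSubst κ t ^ 2) = (1 + t) / (2 * √t) := by
  obtain ⟨w, hw, rfl⟩ : ∃ w : ℝ, 0 < w ∧ t = w ^ 2 :=
    ⟨√t, Real.sqrt_pos.2 ht, (Real.sq_sqrt ht.le).symm⟩
  rw [Real.sqrt_eq_iff_mul_self_eq (by positivity) (by positivity), kSubst, Real.sqrt_sq hw.le]
  field_simp
  ring

lemma sqrt_one_add_sq_kSubst_sub {κ t : ℝ} (hκ : 0 < κ) (ht : 0 < t) :
    √(1 + κ ^ 2 * kSubst κ t ^ 2) - κ * kSubst κ t = √t := by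
  rw [sqrt_one_add_sq_kSubst hκ ht, kSubst]
  have hw : 0 < √t := Real.sqrt_pos.2 ht
  field_simp
  rw [Real.sq_sqrt ht.le]
  ring

lemma kexp_neg_kSubst {κ t : ℝ} (hκ : 0 < κ) (ht : 0 < t) :
    kexp κ (-kSubst κ t) = t ^ (1 / (2 * κ)) := by
  rw [kexp, neg_sq, mul_neg, ← sub_eq_add_neg, sqrt_one_add_sq_kSubst_sub hκ ht,
    Real.sqrt_eq_rpow, ← Real.rpow_mul ht.le]
  congr 1
  field_simp

lemma injOn_kSubst {κ : ℝ} (hκ : 0 < κ) : InjOn (kSubst κ) (Ioo 0 1) := by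
  intro s hs t ht hst
  have h := sqrt_one_add_sq_kSubst_sub hκ hs.1
  rw [hst, sqrt_one_add_sq_kSubst_sub hκ ht.1] at h
  exact ((Real.sqrt_inj ht.1.le hs.1.le).1 h).symm

lemma image_kSubst {κ : ℝ} (hκ : 0 < κ) : kSubst κ '' Ioo 0 1 = Ioi 0 := by
  ext u
  constructor
  · rintro ⟨t, ht, rfl⟩
    exact div_pos (sub_pos.2 ht.2) (by have := Real.sqrt_pos.2 ht.1; positivity)
  · intro hu
    have hu : 0 < u := hu
    have hsq : √(1 + κ ^ 2 * u ^ 2) ^ 2 = 1 + κ ^ 2 * u ^ 2 := Real.sq_sqrt (by positivity)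
    have hs : 0 ≤ √(1 + κ ^ 2 * u ^ 2) := Real.sqrt_nonneg _
    set S := √(1 + κ ^ 2 * u ^ 2)
    have hκu : 0 < κ * u := by positivity
    have h0 : 0 < S - κ * u := by nlinarith
    have h1 : S - κ * u < 1 := by nlinarith
    refine ⟨(S - κ * u) ^ 2, ⟨by positivity, by nlinarith⟩, ?_⟩
    rw [kSubst, Real.sqrt_sq h0.le, div_eq_iff (by positivity)]
    linear_combination -hsq

lemma hasDerivAt_kSubst {κ t : ℝ} (hκ : 0 < κ) (ht : 0 < t) :
    HasDerivAt (kSubst κ) (-((1 + t) / (4 * κ * t * √t))) t := by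
  have hw : 0 < √t := Real.sqrt_pos.2 ht
  have h := ((hasDerivAt_id' t).const_sub 1).div
    ((Real.hasDerivAt_sqrt ht.ne').const_mul (2 * κ)) (by positivity)
  refine h.congr_deriv ?_
  have hsq := Real.sq_sqrt ht.le
  generalize √t = w at *
  subst hsq
  field_simp
  ring

lemma integral_rpow_mul_one_sub_rpow_s9 {a b : ℝ} (ha : 0 < a) (hb : 0 < b) :
    ∫ t in Ioo (0 : ℝ) 1, t ^ (a - 1) * (1 - t) ^ (b - 1) =
      Real.Gamma a * Real.Gamma b / Real.Gamma (a + b) := by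
  change _ = ProbabilityTheory.beta a b
  have h : Complex.betaIntegral a b =
      ((∫ t in (0 : ℝ)..1, t ^ (a - 1) * (1 - t) ^ (b - 1) : ℝ) : ℂ) := by
    rw [Complex.betaIntegral, ← intervalIntegral.integral_ofReal]
    refine intervalIntegral.integral_congr fun t ht => ?_
    rw [uIcc_of_le zero_le_one] at ht
    rw [Complex.ofReal_mul, Complex.ofReal_cpow ht.1, Complex.ofReal_cpow (sub_nonneg.2 ht.2)]
    push_cast
    rfl
  rw [ProbabilityTheory.beta_eq_betaIntegralReal a b ha hb, h, Complex.ofReal_re,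
    intervalIntegral.integral_of_le zero_le_one, integral_Ioc_eq_integral_Ioo]

/-- The Mellin transform of `exp_κ(-u) / √(1 + κ² u²)`. -/
lemma integral_rpow_mul_kexp_neg_div_sqrt {κ p : ℝ} (hκ : κ ∈ Ioo (0 : ℝ) 1) (hp : 0 < p)
    (h : κ * (p - 1) < 1) :
    ∫ u in Ioi (0 : ℝ), u ^ (p - 1) * (kexp κ (-u) / √(1 + κ ^ 2 * u ^ 2)) =
      (2 * κ) ^ (1 - p) * (Real.Gamma p / (1 + κ * (p - 1)) *
        (Real.Gamma (1 / (2 * κ) - (p - 1) / 2) / Real.Gamma (1 / (2 * κ) + (p - 1) / 2))) := by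
  obtain ⟨hκ0, hκ1⟩ := hκ
  have h2κ : 0 < 2 * κ := by positivity
  have hq : 0 < 1 + κ * (p - 1) := by nlinarith
  have ha : 0 < 1 / (2 * κ) - (p - 1) / 2 := by
    have : 1 / (2 * κ) - (p - 1) / 2 = (1 - κ * (p - 1)) / (2 * κ) := by field_simp
    rw [this]
    exact div_pos (by linarith) h2κ
  have hb : 1 / (2 * κ) + (p - 1) / 2 = (1 + κ * (p - 1)) / (2 * κ) := by field_simp
  have hb0 : 0 < 1 / (2 * κ) + (p - 1) / 2 := by rw [hb]; positivity
  have key : ∀ t ∈ Ioo (0 : ℝ) 1,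
      |-((1 + t) / (4 * κ * t * √t))| • (kSubst κ t ^ (p - 1) *
        (kexp κ (-kSubst κ t) / √(1 + κ ^ 2 * kSubst κ t ^ 2))) =
      (2 * κ) ^ (-p) * (t ^ (1 / (2 * κ) - (p - 1) / 2 - 1) * (1 - t) ^ (p - 1)) := by
    rintro t ⟨ht0, ht1⟩
    have hw : 0 < √t := Real.sqrt_pos.2 ht0
    have hpow : √t ^ (p - 1) = t ^ ((p - 1) / 2) := by
      rw [Real.sqrt_eq_rpow, ← Real.rpow_mul ht0.le]
      congr 1
      ring
    rw [abs_neg, abs_of_pos (by positivity), smul_eq_mul, kexp_neg_kSubst hκ0 ht0,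
      sqrt_one_add_sq_kSubst hκ0 ht0, kSubst, Real.div_rpow (by linarith) (by positivity),
      Real.mul_rpow h2κ.le hw.le, hpow, Real.rpow_sub_one ht0.ne', Real.rpow_sub ht0,
      Real.rpow_sub_one h2κ.ne' p, Real.rpow_neg h2κ.le]
    have := Real.rpow_pos_of_pos h2κ p
    have := Real.rpow_pos_of_pos ht0 ((p - 1) / 2)
    generalize t ^ (1 / (2 * κ)) = A
    generalize t ^ ((p - 1) / 2) = B at *
    generalize (2 * κ) ^ p = D at *
    generalize (1 - t) ^ (p - 1) = E
    field_simp
    ring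
  rw [← image_kSubst hκ0, integral_image_eq_integral_abs_deriv_smul measurableSet_Ioo
    (fun t ht => (hasDerivAt_kSubst hκ0 ht.1).hasDerivWithinAt) (injOn_kSubst hκ0),
    setIntegral_congr_fun measurableSet_Ioo key, integral_const_mul,
    integral_rpow_mul_one_sub_rpow_s9 ha hp,
    show 1 / (2 * κ) - (p - 1) / 2 + p = 1 / (2 * κ) + (p - 1) / 2 + 1 by ring,
    Real.Gamma_add_one hb0.ne', show (1 : ℝ) - p = -p + 1 by ring, Real.rpow_add_one h2κ.ne']
  have hG := Real.Gamma_pos_of_pos hb0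
  generalize Real.Gamma (1 / (2 * κ) + (p - 1) / 2) = G at *
  rw [hb]
  field_simp

/-- The raw moments of the κGG distribution. -/
lemma integral_rpow_mul_kGG {α ν β κ r : ℝ} (hα : 0 < α) (hν : 0 < ν) (hβ : 0 < β)
    (hκ : κ ∈ Ioo (0 : ℝ) 1) (hr : 0 ≤ r) (h : κ * ((α + r) / ν - 1) < 1) :
    ∫ x in Ioi (0 : ℝ), x ^ r * kGG α ν β κ x =
      β ^ r / (2 * κ) ^ (r / ν) * ((1 + κ * (α / ν - 1)) / Real.Gamma (α / ν)) *
        (Real.Gamma (1 / (2 * κ) + (α - ν) / (2 * ν)) /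
          Real.Gamma (1 / (2 * κ) - (α - ν) / (2 * ν))) *
        (Real.Gamma ((α + r) / ν) / (1 + κ * ((α + r) / ν - 1)) *
          (Real.Gamma (1 / (2 * κ) - (α - ν + r) / (2 * ν)) /
            Real.Gamma (1 / (2 * κ) + (α - ν + r) / (2 * ν)))) := by
  have h2κ : 0 < 2 * κ := mul_pos two_pos hκ.1
  have hz : 0 < 1 - κ * (α / ν - 1) := by
    have : κ * (α / ν) ≤ κ * ((α + r) / ν) :=
      mul_le_mul_of_nonneg_left (div_le_div_of_nonneg_right (by linarith) hν.le) hκ.1.le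
    linarith
  have hp : 0 < (α + r) / ν := by positivity
  set C := (1 - κ ^ 2 * (α / ν - 1) ^ 2) * (kGamma κ (α / ν))⁻¹ with hC
  have key : ∀ y ∈ Ioi (0 : ℝ), (β * y) ^ r * kGG α ν β κ (β * y) =
      β ^ r * β⁻¹ * C * ((ν * y ^ (ν - 1)) • ((y ^ ν) ^ ((α + r) / ν - 1) *
        (kexp κ (-(y ^ ν)) / √(1 + κ ^ 2 * (y ^ ν) ^ 2)))) := by
    intro y hy
    have hy : 0 < y := hy
    have h1 : (y ^ ν) ^ (2 : ℕ) = y ^ (2 * ν) := by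
      rw [← Real.rpow_natCast, ← Real.rpow_mul hy.le]
      congr 1
      push_cast
      ring
    have h2 : y ^ r * y ^ (α - 1) = y ^ (ν - 1) * (y ^ ν) ^ ((α + r) / ν - 1) := by
      rw [← Real.rpow_mul hy.le, ← Real.rpow_add hy, ← Real.rpow_add hy]
      congr 1
      field_simp
      ring
    rw [kGG, mul_div_cancel_left₀ y hβ.ne', Real.mul_rpow hβ.le hy.le, h1, smul_eq_mul, hC]
    linear_combination (β ^ r * β⁻¹ * ((1 - κ ^ 2 * (α / ν - 1) ^ 2) * (kGamma κ (α / ν))⁻¹) * ν *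
      (kexp κ (-(y ^ ν)) / √(1 + κ ^ 2 * y ^ (2 * ν)))) * h2
  have hscale := integral_comp_mul_left_Ioi' (fun x => x ^ r * kGG α ν β κ x) 0 hβ
  rw [mul_zero] at hscale
  rw [← hscale, setIntegral_congr_fun measurableSet_Ioi key, integral_const_mul,
    integral_comp_rpow_Ioi_of_pos
      (g := fun u => u ^ ((α + r) / ν - 1) * (kexp κ (-u) / √(1 + κ ^ 2 * u ^ 2))) hν,
    integral_rpow_mul_kexp_neg_div_sqrt hκ hp h, hC, kGamma,
    show (α - ν) / (2 * ν) = (α / ν - 1) / 2 by field_simp,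
    show (α - ν + r) / (2 * ν) = ((α + r) / ν - 1) / 2 by field_simp; ring,
    show 1 - (α + r) / ν = -(α / ν - 1) - r / ν by field_simp; ring,
    Real.rpow_sub h2κ (-(α / ν - 1)), Real.rpow_neg h2κ.le, smul_eq_mul]
  have hD := (Real.rpow_pos_of_pos h2κ (α / ν - 1)).ne'
  generalize Real.Gamma (1 / (2 * κ) - ((α + r) / ν - 1) / 2) /
    Real.Gamma (1 / (2 * κ) + ((α + r) / ν - 1) / 2) = R
  generalize Real.Gamma ((α + r) / ν) / (1 + κ * ((α + r) / ν - 1)) = Q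
  generalize (2 * κ) ^ (α / ν - 1) = D at *
  rw [show 1 - κ ^ 2 * (α / ν - 1) ^ 2 = (1 - κ * (α / ν - 1)) * (1 + κ * (α / ν - 1)) by ring]
  generalize α / ν - 1 = z at *
  have hz' := hz.ne'
  have hβ' := hβ.ne'
  simp only [mul_inv, div_eq_mul_inv, inv_inv]
  field_simp

/-- The variance of the κGG distribution. -/
theorem kGG_variance (α ν β κ m : ℝ) (hα : 0 < α) (hν : 0 < ν) (hβ : 0 < β)
    (hκ : κ ∈ Set.Ioo (0:ℝ) 1) (h : κ * (α/ν - 1) < 1)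
    (hmom : 2 < ν/κ + (ν - α))
    (hm : m = ∫ x in Set.Ioi (0:ℝ), x * kGG α ν β κ x) :
    (∫ x in Set.Ioi (0:ℝ), x ^ 2 * kGG α ν β κ x) - m ^ 2 =
      β ^ 2 * ((1 + κ*(α/ν - 1)) / ((2*κ) ^ ((2:ℝ)/ν) * Real.Gamma (α/ν))) *
      (Real.Gamma (1/(2*κ) + (α-ν)/(2*ν)) / Real.Gamma (1/(2*κ) - (α-ν)/(2*ν))) *
      ( Real.Gamma ((α+2)/ν) / (1 + κ*((α+2)/ν - 1)) *
          (Real.Gamma (1/(2*κ) - (α-ν+2)/(2*ν)) / Real.Gamma (1/(2*κ) + (α-ν+2)/(2*ν)))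
        - (1 + κ*(α/ν - 1)) / Real.Gamma (α/ν) *
          (Real.Gamma (1/(2*κ) + (α-ν)/(2*ν)) / Real.Gamma (1/(2*κ) - (α-ν)/(2*ν))) *
          ( Real.Gamma ((α+1)/ν) / (1 + κ*((α+1)/ν - 1)) *
            (Real.Gamma (1/(2*κ) - (α-ν+1)/(2*ν)) /
              Real.Gamma (1/(2*κ) + (α-ν+1)/(2*ν))) ) ^ 2 ) := by
  have hκ0 := hκ.1
  have bound : ∀ r ≤ (2 : ℝ), κ * ((α + r) / ν - 1) < 1 := by
    intro r hr
    have h1 : α + r - ν < ν / κ := by linarith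
    rw [lt_div_iff₀ hκ0] at h1
    have h2 : κ * ((α + r) / ν - 1) = (α + r - ν) * κ / ν := by field_simp
    rw [h2, div_lt_one hν]
    exact h1
  have moment_one := integral_rpow_mul_kGG (r := 1) hα hν hβ hκ zero_le_one
    (bound 1 one_le_two)
  have moment_two := integral_rpow_mul_kGG (r := 2) hα hν hβ hκ zero_le_two (bound 2 le_rfl)
  simp only [Real.rpow_one] at moment_one
  simp only [Real.rpow_two] at moment_two
  have hpow : (2 * κ) ^ ((2 : ℝ) / ν) = ((2 * κ) ^ ((1 : ℝ) / ν)) ^ 2 := by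
    rw [← Real.rpow_natCast, ← Real.rpow_mul (by positivity)]
    congr 1
    push_cast
    ring
  rw [hm, moment_one, moment_two, hpow]
  ring
end
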